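/- For every nonzero real number f, the linear automorphism τ_f^S of S determined on the basis by X₀ ↦ fX₀, 𝒥₁X₀ ↦ f𝒥₁X₀, 𝒥₂X₀ ↦ (1/f)𝒥₂X₀, 𝒥₃X₀ ↦ (1/f)𝒥₃X₀ is an isometry of the canonical pairing: ⟨τ_f^S u, τ_f^S v⟩ = ⟨u, v⟩ for all u, v ∈ S. -/

import Mathlib

open Module

/-- The generalized tangent space `W = V ⊕ V*`. -/
abbrev GT (V : Type*) [AddCommGroup V] [Module ℝ V] := V × Module.Dual ℝ V

/-- The canonical symmetric pairing on `W = V ⊕ V*`. -/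
noncomputable def gpair {V : Type*} [AddCommGroup V] [Module ℝ V] (u v : GT V) : ℝ :=
  (1 / 2) * (v.2 u.1 + u.2 v.1)

/-- A generalized almost complex structure on `V`. -/
def IsGacs {V : Type*} [AddCommGroup V] [Module ℝ V] (J : GT V →ₗ[ℝ] GT V) : Prop :=
  (∀ u, J (J u) = -u) ∧ (∀ u v, gpair (J u) v = - gpair u (J v))

/-- A generalized almost Hermitian structure on `V`. -/
structure IsGah {V : Type*} [AddCommGroup V] [Module ℝ V]
    (G : GT V →ₗ[ℝ] GT V →ₗ[ℝ] ℝ) (J Gend : GT V →ₗ[ℝ] GT V) : Prop where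
  gacs : IsGacs J
  symm : ∀ u v, G u v = G v u
  posdef : ∀ u, u ≠ 0 → 0 < G u u
  hermitian : ∀ u v, G (J u) (J v) = G u v
  gend_pair : ∀ u v, G u v = gpair (Gend u) v
  gend_sq : ∀ u, Gend (Gend u) = u

section Pairing

variable {V : Type*} [AddCommGroup V] [Module ℝ V]

theorem gpair_comm (u v : GT V) : gpair u v = gpair v u := by
  simp [gpair, add_comm]

theorem gpair_add_left (u v w : GT V) : gpair (u + v) w = gpair u w + gpair v w := by
  simp [gpair]
  ring

theorem gpair_add_right (u v w : GT V) : gpair u (v + w) = gpair u v + gpair u w := by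
  simp [gpair]
  ring

theorem gpair_smul_left (a : ℝ) (u v : GT V) : gpair (a • u) v = a * gpair u v := by
  simp [gpair]
  ring

theorem gpair_smul_right (a : ℝ) (u v : GT V) : gpair u (a • v) = a * gpair u v := by
  simp [gpair]
  ring

theorem gpair_neg_right (u v : GT V) : gpair u (-v) = -gpair u v := by
  simp [gpair]
  ring

theorem IsGacs.gpair_self_apply {J : GT V →ₗ[ℝ] GT V} (hJ : IsGacs J) (u : GT V) :
    gpair u (J u) = 0 := by
  linarith [hJ.2 u u, gpair_comm u (J u)]

theorem IsGacs.gpair_apply_apply {J : GT V →ₗ[ℝ] GT V} (hJ : IsGacs J) (u v : GT V) :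
    gpair (J u) (J v) = gpair u v := by
  rw [hJ.2, hJ.1, gpair_neg_right, neg_neg]

theorem IsGah.gpair_gend_gend {G : GT V →ₗ[ℝ] GT V →ₗ[ℝ] ℝ} {J Gend : GT V →ₗ[ℝ] GT V}
    (h : IsGah G J Gend) (u v : GT V) : gpair (Gend u) (Gend v) = gpair u v := by
  rw [← h.gend_pair, h.symm, h.gend_pair, h.gend_sq, gpair_comm]

/-- A map scaling one isotropic pair of vectors by `f` and another by `f⁻¹` preserves the
canonical pairing on their joint span. -/
theorem gpair_map_map_of_mem_span {a b c d : GT V} {f : ℝ} (hf : f ≠ 0)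
    (haa : gpair a a = 0) (hab : gpair a b = 0) (hbb : gpair b b = 0)
    (hcc : gpair c c = 0) (hcd : gpair c d = 0) (hdd : gpair d d = 0)
    {T : GT V →ₗ[ℝ] GT V} (ha : T a = f • a) (hb : T b = f • b)
    (hc : T c = f⁻¹ • c) (hd : T d = f⁻¹ • d) {u v : GT V}
    (hu : u ∈ Submodule.span ℝ {a, b, c, d}) (hv : v ∈ Submodule.span ℝ {a, b, c, d}) :
    gpair (T u) (T v) = gpair u v := by
  simp only [Submodule.mem_span_insert, Submodule.mem_span_singleton] at hu hv
  obtain ⟨p, _, ⟨q, _, ⟨r, _, ⟨s, rfl⟩, rfl⟩, rfl⟩, rfl⟩ := hu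
  obtain ⟨p', _, ⟨q', _, ⟨r', _, ⟨s', rfl⟩, rfl⟩, rfl⟩, rfl⟩ := hv
  have hba : gpair b a = 0 := by rw [gpair_comm, hab]
  have hdc : gpair d c = 0 := by rw [gpair_comm, hcd]
  simp only [map_add, map_smul, ha, hb, hc, hd, gpair_add_left, gpair_add_right,
    gpair_smul_left, gpair_smul_right, haa, hab, hba, hbb, hcc, hcd, hdc, hdd]
  field_simp
  ring

end Pairing

/-- for every nonzero real `f`, any linear map whose values on the basis
`X₀, 𝒥₁X₀, 𝒥₂X₀, 𝒥₃X₀` of `S` are `fX₀, f𝒥₁X₀, (1/f)𝒥₂X₀, (1/f)𝒥₃X₀` (i.e. the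
automorphism `τ_f^S` of `S`) is an isometry of the canonical pairing on `S`. -/
theorem statement8 {V : Type*} [AddCommGroup V] [Module ℝ V] [FiniteDimensional ℝ V]
    (G : GT V →ₗ[ℝ] GT V →ₗ[ℝ] ℝ) (J Gend : GT V →ₗ[ℝ] GT V)
    (hGah : IsGah G J Gend) (X₀ : V) (hX₀ : X₀ ≠ 0) (f : ℝ) (hf : f ≠ 0) :
    letI e : GT V := (X₀, 0)
    letI J₂ : GT V →ₗ[ℝ] GT V := Gend ∘ₗ J
    letI J₃ : GT V →ₗ[ℝ] GT V := J ∘ₗ Gend ∘ₗ J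
    letI S : Submodule ℝ (GT V) := Submodule.span ℝ {e, J e, J₂ e, J₃ e}
    ∀ T : GT V →ₗ[ℝ] GT V,
      T e = f • e → T (J e) = f • J e →
      T (J₂ e) = f⁻¹ • J₂ e → T (J₃ e) = f⁻¹ • J₃ e →
      ∀ u ∈ S, ∀ v ∈ S, gpair (T u) (T v) = gpair u v := by
  intro T h₀ h₁ h₂ h₃ u hu v hv
  have hJ := hGah.gacs
  have he : gpair ((X₀, 0) : GT V) (X₀, 0) = 0 := by simp [gpair]
  have hJe : gpair (J (X₀, 0)) (J (X₀, 0)) = 0 := by rw [hJ.gpair_apply_apply, he]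
  have hGJe : gpair (Gend (J (X₀, 0))) (Gend (J (X₀, 0))) = 0 := by
    rw [hGah.gpair_gend_gend, hJe]
  exact gpair_map_map_of_mem_span hf he (hJ.gpair_self_apply _) hJe hGJe
    (hJ.gpair_self_apply _) ((hJ.gpair_apply_apply _ _).trans hGJe) h₀ h₁ h₂ h₃ hu hv
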